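/- Let a = 4 and define q_n = ∑_{k=0}^n C(n,k)⁴·k!, p_{n,1} = ∑_{k=0}^n C(n,k)⁴·k!·r_1(k), and p_{n,2} = ∑_{k=0}^n C(n,k)⁴·k!·(r_1(k)² + r_2(k)). Then each of the three sequences f_n = q_n, f_n = p_{n,1}, f_n = p_{n,2} satisfies, for every integer n ≥ 2, the recurrence (n+2)²(729n⁴−162n³−171n²−4n+6)·f_{n+2} = (2916n⁷+14661n⁶+20862n⁵+947n⁴−13008n³−2370n²+1320n+312)·f_{n+1} − (4374n⁸−18468n⁷−82674n⁶−85776n⁵−13062n⁴+24204n³+13528n²+2680n+168)·f_n + n²(2916n⁷+28512n⁶+61848n⁵+37667n⁴−12898n³−17463n²−2692n+398)·f_{n−1} − n²(n−1)⁴(729n⁴+2754n³+3717n²+2084n+398)·f_{n−2}. -/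

import Mathlib

/-- Generalized harmonic number `H_n^{(2)} = ∑_{j=1}^n 1/j²`. -/
noncomputable def genHarmonic2 (n : ℕ) : ℚ :=
  ∑ j ∈ Finset.range n, (1 : ℚ) / ((j : ℚ) + 1) ^ 2

/-- `r_1(k) = 4·H_{n-k} - 3·H_k`. -/
noncomputable def r1 (n k : ℕ) : ℚ := 4 * harmonic (n - k) - 3 * harmonic k

/-- `r_2(k) = 4·H_{n-k}^{(2)} + 3·H_k^{(2)}`. -/
noncomputable def r2 (n k : ℕ) : ℚ := 4 * genHarmonic2 (n - k) + 3 * genHarmonic2 k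

/-- `q_n = ∑_{k=0}^n C(n,k)⁴ · k!`. -/
noncomputable def qseq4 (n : ℕ) : ℚ :=
  ∑ k ∈ Finset.range (n + 1), (n.choose k : ℚ) ^ 4 * (Nat.factorial k : ℚ)

/-- `p_{n,1} = ∑_{k=0}^n C(n,k)⁴ · k! · r_1(k)`. -/
noncomputable def pseq41 (n : ℕ) : ℚ :=
  ∑ k ∈ Finset.range (n + 1), (n.choose k : ℚ) ^ 4 * (Nat.factorial k : ℚ) * r1 n k

/-- `p_{n,2} = ∑_{k=0}^n C(n,k)⁴ · k! · (r_1(k)² + r_2(k))`. -/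
noncomputable def pseq42 (n : ℕ) : ℚ :=
  ∑ k ∈ Finset.range (n + 1), (n.choose k : ℚ) ^ 4 * (Nat.factorial k : ℚ) *
    ((r1 n k) ^ 2 + r2 n k)

/-- The homogeneous fourth-order recurrence from Example 2 (case `a = 4`). -/
def Rec4 (f : ℕ → ℚ) : Prop :=
  ∀ n : ℕ, 2 ≤ n →
    ((n : ℚ) + 2) ^ 2 *
        (729 * (n : ℚ) ^ 4 - 162 * (n : ℚ) ^ 3 - 171 * (n : ℚ) ^ 2 - 4 * (n : ℚ) + 6) *
        f (n + 2) =
      (2916 * (n : ℚ) ^ 7 + 14661 * (n : ℚ) ^ 6 + 20862 * (n : ℚ) ^ 5 + 947 * (n : ℚ) ^ 4 -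
          13008 * (n : ℚ) ^ 3 - 2370 * (n : ℚ) ^ 2 + 1320 * (n : ℚ) + 312) * f (n + 1) -
        (4374 * (n : ℚ) ^ 8 - 18468 * (n : ℚ) ^ 7 - 82674 * (n : ℚ) ^ 6 - 85776 * (n : ℚ) ^ 5 -
          13062 * (n : ℚ) ^ 4 + 24204 * (n : ℚ) ^ 3 + 13528 * (n : ℚ) ^ 2 + 2680 * (n : ℚ) +
          168) * f n +
        (n : ℚ) ^ 2 *
          (2916 * (n : ℚ) ^ 7 + 28512 * (n : ℚ) ^ 6 + 61848 * (n : ℚ) ^ 5 +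
            37667 * (n : ℚ) ^ 4 - 12898 * (n : ℚ) ^ 3 - 17463 * (n : ℚ) ^ 2 - 2692 * (n : ℚ) +
            398) * f (n - 1) -
        (n : ℚ) ^ 2 * ((n : ℚ) - 1) ^ 4 *
          (729 * (n : ℚ) ^ 4 + 2754 * (n : ℚ) ^ 3 + 3717 * (n : ℚ) ^ 2 + 2084 * (n : ℚ) + 398) *
          f (n - 2)

section Jets

variable {R : Type*} [CommRing R]

/-- Coefficient of `f (n + 2)` in `Rec4`. -/
def recCoeffAddTwo (n : R) : R :=
  (n + 2) ^ 2 * (729 * n ^ 4 - 162 * n ^ 3 - 171 * n ^ 2 - 4 * n + 6)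

/-- Coefficient of `f (n + 1)` in `Rec4`. -/
def recCoeffAddOne (n : R) : R :=
  2916 * n ^ 7 + 14661 * n ^ 6 + 20862 * n ^ 5 + 947 * n ^ 4 - 13008 * n ^ 3 - 2370 * n ^ 2 +
    1320 * n + 312

/-- Coefficient of `f n` in `Rec4`, up to sign. -/
def recCoeffZero (n : R) : R :=
  4374 * n ^ 8 - 18468 * n ^ 7 - 82674 * n ^ 6 - 85776 * n ^ 5 - 13062 * n ^ 4 + 24204 * n ^ 3 +
    13528 * n ^ 2 + 2680 * n + 168

/-- Coefficient of `f (n - 1)` in `Rec4`, without the factor `n ^ 2`. -/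
def recCoeffSubOne (n : R) : R :=
  2916 * n ^ 7 + 28512 * n ^ 6 + 61848 * n ^ 5 + 37667 * n ^ 4 - 12898 * n ^ 3 - 17463 * n ^ 2 -
    2692 * n + 398

/-- Coefficient of `f (n - 2)` in `Rec4`, up to sign and without the factor
`n ^ 2 * (n - 1) ^ 4`. -/
def recCoeffSubTwo (n : R) : R :=
  729 * n ^ 4 + 2754 * n ^ 3 + 3717 * n ^ 2 + 2084 * n + 398

/-- The creative telescoping certificate, in the variables `n` and `s = n + 1 - k`. -/
def certificate (n s : R) : R :=
  (-729 * n ^ 13 - 9315 * n ^ 12 - 50211 * n ^ 11 - 144302 * n ^ 10 - 230966 * n ^ 9 - 188592 * n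
  ^ 8 - 36446 * n ^ 7 + 57415 * n ^ 6 + 42840 * n ^ 5 + 9666 * n ^ 4 + 264 * n ^ 3 - 120 * n ^ 2) +
    (-2187 * n ^ 12 - 25758 * n ^ 11 - 116127 * n ^ 10 - 259674 * n ^ 9 - 300492 * n ^ 8 - 150078
    * n ^ 7 + 23076 * n ^ 6 + 64236 * n ^ 5 + 31064 * n ^ 4 + 7232 * n ^ 3 + 624 * n ^ 2) * s +
    (-4374 * n ^ 11 - 34020 * n ^ 10 - 109296 * n ^ 9 - 198561 * n ^ 8 - 224268 * n ^ 7 - 130599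
    * n ^ 6 + 10614 * n ^ 5 + 59094 * n ^ 4 + 27132 * n ^ 3 + 3456 * n ^ 2) * s ^ 2 +
    (1458 * n ^ 10 + 5508 * n ^ 9 - 37440 * n ^ 8 - 208988 * n ^ 7 - 305702 * n ^ 6 - 104184 * n
    ^ 5 + 82602 * n ^ 4 + 59040 * n ^ 3 + 8652 * n ^ 2) * s ^ 3 +
    (2187 * n ^ 10 + 19197 * n ^ 9 + 24435 * n ^ 8 - 164424 * n ^ 7 - 402711 * n ^ 6 - 220551 * n
    ^ 5 + 91986 * n ^ 4 + 108114 * n ^ 3 + 24477 * n ^ 2 + 304 * n - 398) * s ^ 4 +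
    (4374 * n ^ 9 + 14337 * n ^ 8 - 122040 * n ^ 7 - 378510 * n ^ 6 - 288156 * n ^ 5 + 52239 * n
    ^ 4 + 133698 * n ^ 3 + 35508 * n ^ 2 - 5340 * n - 2388) * s ^ 5 +
    (2187 * n ^ 8 - 67554 * n ^ 7 - 248535 * n ^ 6 - 272127 * n ^ 5 - 50995 * n ^ 4 + 67721 * n ^
    3 + 20025 * n ^ 2 - 8618 * n - 2786) * s ^ 6 +
    (-20412 * n ^ 7 - 103356 * n ^ 6 - 172116 * n ^ 5 - 104387 * n ^ 4 + 1078 * n ^ 3 + 28863 * n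
    ^ 2 + 14588 * n + 2786) * s ^ 7 +
    (-2187 * n ^ 7 - 23571 * n ^ 6 - 58617 * n ^ 5 - 46545 * n ^ 4 + 16254 * n ^ 3 + 49404 * n ^
    2 + 29176 * n + 5572) * s ^ 8 +
    (-2187 * n ^ 6 - 3888 * n ^ 5 + 5373 * n ^ 4 + 16050 * n ^ 3 + 11310 * n ^ 2 + 2388 * n) * s
    ^ 9 +
    (2187 * n ^ 5 + 3159 * n ^ 4 - 8127 * n ^ 3 - 19767 * n ^ 2 - 13394 * n - 2786) * s ^ 10 +
    (-729 * n ^ 4 - 2754 * n ^ 3 - 3717 * n ^ 2 - 2084 * n - 398) * s ^ 11 +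
    (729 * n ^ 4 + 2754 * n ^ 3 + 3717 * n ^ 2 + 2084 * n + 398) * s ^ 12

theorem certificate_identity (n s : R) :
    n ^ 2 * (n + 1) ^ 4 * (n + 2) ^ 4 * recCoeffAddTwo n -
        n ^ 2 * (n + 1) ^ 4 * (s + 1) ^ 4 * recCoeffAddOne n +
        n ^ 2 * ((s + 1) * s) ^ 4 * recCoeffZero n -
        ((s + 1) * s * (s - 1)) ^ 4 * recCoeffSubOne n +
        ((s + 1) * s * (s - 1) * (s - 2)) ^ 4 * recCoeffSubTwo n =
      (s + 1) ^ 4 * certificate n (s - 1) - (n + 1 - s) ^ 3 * certificate n s := by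
  unfold recCoeffAddTwo recCoeffAddOne recCoeffZero recCoeffSubOne recCoeffSubTwo certificate
  ring

/-- Twice the exponential jet `1 + r e + (r² + s) e² / 2`. -/
def expJet (e r s : R) : R := 2 + 2 * r * e + (r ^ 2 + s) * e ^ 2

theorem one_sub_pow_four_mul_expJet {e : R} (he : e ^ 3 = 0) (r s i : R) :
    (1 - i * e) ^ 4 * expJet e (r + 4 * i) (s + 4 * i ^ 2) = expJet e r s := by
  unfold expJet
  linear_combination
    (2 * (-4 * i ^ 3) + 2 * (r + 4 * i) * 6 * i ^ 2
        - 4 * i * ((r + 4 * i) ^ 2 + (s + 4 * i ^ 2))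
      + (2 * i ^ 4 - 8 * (r + 4 * i) * i ^ 3
        + 6 * i ^ 2 * ((r + 4 * i) ^ 2 + (s + 4 * i ^ 2))) * e
      + (2 * (r + 4 * i) * i ^ 4 - 4 * i ^ 3 * ((r + 4 * i) ^ 2 + (s + 4 * i ^ 2))) * e ^ 2
      + ((r + 4 * i) ^ 2 + (s + 4 * i ^ 2)) * i ^ 4 * e ^ 3) * he

theorem one_add_pow_three_mul_expJet {e : R} (he : e ^ 3 = 0) (r s j : R) :
    (1 + j * e) ^ 3 * expJet e (r - 3 * j) (s + 3 * j ^ 2) = expJet e r s := by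
  unfold expJet
  linear_combination
    (2 * j ^ 3 + 6 * (r - 3 * j) * j ^ 2 + 3 * j * ((r - 3 * j) ^ 2 + (s + 3 * j ^ 2))
      + (2 * (r - 3 * j) * j ^ 3 + 3 * j ^ 2 * ((r - 3 * j) ^ 2 + (s + 3 * j ^ 2))) * e
      + ((r - 3 * j) ^ 2 + (s + 3 * j ^ 2)) * j ^ 3 * e ^ 2) * he

variable [Algebra ℚ R]

/-- The jet whose coefficients are the summands of `qseq4`, `pseq41` and `pseq42`. -/
noncomputable def summandJet (e : R) (n k : ℕ) : R :=
  algebraMap ℚ R ((n.choose k : ℚ) ^ 4 * (Nat.factorial k : ℚ)) *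
    expJet e (algebraMap ℚ R (r1 n k)) (algebraMap ℚ R (r2 n k))

theorem summandJet_of_lt (e : R) {n k : ℕ} (h : n < k) : summandJet e n k = 0 := by
  simp [summandJet, Nat.choose_eq_zero_of_lt h]

theorem genHarmonic2_succ (n : ℕ) :
    genHarmonic2 (n + 1) = genHarmonic2 n + (((n : ℚ) + 1)⁻¹) ^ 2 := by
  simp [genHarmonic2, Finset.sum_range_succ]

theorem mul_summandJet_succ_left {e : R} (he : e ^ 3 = 0) (n k : ℕ) :
    ((n : R) + 1 - k - e) ^ 4 * summandJet e (n + 1) k = ((n : R) + 1) ^ 4 * summandJet e n k := by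
  rcases lt_trichotomy k (n + 1) with h | rfl | h
  · obtain ⟨d, rfl⟩ := Nat.exists_eq_add_of_le (Nat.lt_succ_iff.mp h)
    have hd : (d : ℚ) + 1 ≠ 0 := by positivity
    have hr1 : r1 (k + d + 1) k = r1 (k + d) k + 4 * ((d : ℚ) + 1)⁻¹ := by
      simp only [r1, show k + d + 1 - k = d + 1 by omega, show k + d - k = d by omega,
        harmonic_succ]
      push_cast
      ring
    have hr2 : r2 (k + d + 1) k = r2 (k + d) k + 4 * (((d : ℚ) + 1)⁻¹) ^ 2 := by
      simp only [r2, show k + d + 1 - k = d + 1 by omega, show k + d - k = d by omega,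
        genHarmonic2_succ]
      ring
    have hi : ((d : R) + 1) * algebraMap ℚ R (((d : ℚ) + 1)⁻¹) = 1 := by
      simpa only [map_mul, map_add, map_natCast, map_one] using
        congrArg (algebraMap ℚ R) (mul_inv_cancel₀ hd)
    have hc : ((d : ℚ) + 1) * ((k + d + 1).choose k : ℚ) =
        ((k : ℚ) + d + 1) * ((k + d).choose k : ℚ) := by
      have := Nat.add_one_mul_choose_eq (k + d) d
      have h1 : (k + d).choose d = (k + d).choose k := Nat.choose_symm_add.symm
      have h2 : (k + d + 1).choose (d + 1) = (k + d + 1).choose k :=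
        (Nat.choose_symm_of_eq_add (by omega)).symm
      rw [h1, h2] at this
      have := congrArg (Nat.cast : ℕ → ℚ) this
      push_cast at this
      linarith
    have hc' := congrArg (algebraMap ℚ R) hc
    simp only [map_mul, map_add, map_natCast, map_one] at hc'
    have key := one_sub_pow_four_mul_expJet he (algebraMap ℚ R (r1 (k + d) k))
      (algebraMap ℚ R (r2 (k + d) k)) (algebraMap ℚ R (((d : ℚ) + 1)⁻¹))
    simp only [summandJet, hr1, hr2, map_mul, map_add, map_pow, map_natCast, map_ofNat]
    rw [← key]
    have hs : ((k + d : ℕ) : R) + 1 - k - e =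
        ((d : R) + 1) * (1 - algebraMap ℚ R (((d : ℚ) + 1)⁻¹) * e) := by
      push_cast
      linear_combination e * hi
    rw [hs]
    push_cast
    have h4 := congrArg (· ^ 4) hc'
    simp only [mul_pow] at h4 ⊢
    linear_combination (Nat.factorial k : R) *
      (1 - algebraMap ℚ R (((d : ℚ) + 1)⁻¹) * e) ^ 4 *
      expJet e (algebraMap ℚ R (r1 (k + d) k) + 4 * algebraMap ℚ R (((d : ℚ) + 1)⁻¹))
        (algebraMap ℚ R (r2 (k + d) k) + 4 * algebraMap ℚ R (((d : ℚ) + 1)⁻¹) ^ 2) * h4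
  · rw [summandJet_of_lt e (Nat.lt_succ_self n)]
    push_cast
    linear_combination e * summandJet e (n + 1) (n + 1) * he
  · rw [summandJet_of_lt e h, summandJet_of_lt e (Nat.lt_of_succ_lt h), mul_zero, mul_zero]

theorem mul_summandJet_succ_right {e : R} (he : e ^ 3 = 0) (n k : ℕ) :
    ((k : R) + 1 + e) ^ 3 * summandJet e n (k + 1) = ((n : R) - k - e) ^ 4 * summandJet e n k := by
  rcases lt_trichotomy k n with h | rfl | h
  · obtain ⟨d, rfl⟩ := Nat.exists_eq_add_of_le (Nat.succ_le_of_lt h)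
    have hd : (d : ℚ) + 1 ≠ 0 := by positivity
    have hk : (k : ℚ) + 1 ≠ 0 := by positivity
    have e1 : k.succ + d - k = d + 1 := by omega
    have e2 : k.succ + d - (k + 1) = d := by omega
    set r := 4 * harmonic d - 3 * harmonic k with hr
    set s := 4 * genHarmonic2 d + 3 * genHarmonic2 k with hs
    set i := ((d : ℚ) + 1)⁻¹ with hi
    set j := ((k : ℚ) + 1)⁻¹ with hj
    have hr1 : r1 (k.succ + d) k = r + 4 * i := by
      simp only [r1, e1, harmonic_succ, hr, hi]
      push_cast
      ring
    have hr2 : r2 (k.succ + d) k = s + 4 * i ^ 2 := by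
      simp only [r2, e1, genHarmonic2_succ, hs, hi]
      ring
    have hr1' : r1 (k.succ + d) (k + 1) = r - 3 * j := by
      simp only [r1, e2, harmonic_succ, hr, hj]
      push_cast
      ring
    have hr2' : r2 (k.succ + d) (k + 1) = s + 3 * j ^ 2 := by
      simp only [r2, e2, genHarmonic2_succ, hs, hj]
      ring
    have hdi : ((d : R) + 1) * algebraMap ℚ R i = 1 := by
      simpa only [map_mul, map_add, map_natCast, map_one] using
        congrArg (algebraMap ℚ R) (mul_inv_cancel₀ hd)
    have hkj : ((k : R) + 1) * algebraMap ℚ R j = 1 := by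
      simpa only [map_mul, map_add, map_natCast, map_one] using
        congrArg (algebraMap ℚ R) (mul_inv_cancel₀ hk)
    have hc := Nat.choose_succ_right_eq (k.succ + d) k
    rw [e1] at hc
    have hc' := congrArg (Nat.cast : ℕ → R) hc
    push_cast at hc'
    have key := one_sub_pow_four_mul_expJet he (algebraMap ℚ R r) (algebraMap ℚ R s)
      (algebraMap ℚ R i)
    have key' := one_add_pow_three_mul_expJet he (algebraMap ℚ R r) (algebraMap ℚ R s)
      (algebraMap ℚ R j)
    have hn : ((k.succ + d : ℕ) : R) - k - e = ((d : R) + 1) * (1 - algebraMap ℚ R i * e) := by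
      push_cast
      linear_combination e * hdi
    have hk' : (k : R) + 1 + e = ((k : R) + 1) * (1 + algebraMap ℚ R j * e) := by
      linear_combination -e * hkj
    rw [hn, hk']
    simp only [summandJet, hr1, hr2, hr1', hr2', map_mul, map_add, map_sub, map_pow, map_natCast,
      map_ofNat, Nat.factorial_succ, Nat.cast_mul, Nat.cast_add, Nat.cast_one, map_one]
    have h4 := congrArg (· ^ 4) hc'
    simp only [mul_pow, Nat.succ_eq_add_one] at h4 key key' ⊢
    linear_combination (Nat.factorial k : R) * expJet e (algebraMap ℚ R r) (algebraMap ℚ R s) * h4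
      + ((k : R) + 1) ^ 4 * ((k + 1 + d).choose (k + 1) : R) ^ 4 * (Nat.factorial k : R) * key'
      - ((d : R) + 1) ^ 4 * ((k + 1 + d).choose k : R) ^ 4 * (Nat.factorial k : R) * key
  · rw [summandJet_of_lt e (Nat.lt_succ_self k)]
    linear_combination -e * summandJet e k k * he
  · rw [summandJet_of_lt e h, summandJet_of_lt e (Nat.lt_succ_of_lt h), mul_zero, mul_zero]

theorem summandJet_telescoping {e : R} (he : e ^ 3 = 0) (m k : ℕ) (n : R) (hn : n = m + 2) :
    n ^ 2 * (n + 1) ^ 4 * (n + 2) ^ 4 *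
        (recCoeffAddTwo n * summandJet e (m + 4) k - recCoeffAddOne n * summandJet e (m + 3) k +
          recCoeffZero n * summandJet e (m + 2) k -
          n ^ 2 * recCoeffSubOne n * summandJet e (m + 1) k +
          n ^ 2 * (n - 1) ^ 4 * recCoeffSubTwo n * summandJet e m k) =
      ((k + 1 : ℕ) + e) ^ 3 * certificate n (n + 1 - (k + 1 : ℕ) - e) *
          summandJet e (m + 4) (k + 1) -
        (k + e) ^ 3 * certificate n (n + 1 - k - e) * summandJet e (m + 4) k := by
  obtain ⟨s, hs⟩ : ∃ s, s = n + 1 - k - e := ⟨_, rfl⟩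
  have h1 := mul_summandJet_succ_left he m k
  have h2 := mul_summandJet_succ_left he (m + 1) k
  have h3 := mul_summandJet_succ_left he (m + 2) k
  have h4 := mul_summandJet_succ_left he (m + 3) k
  have hk := mul_summandJet_succ_right he (m + 4) k
  have hid := certificate_identity n s
  have hm : (m : R) = n - 2 := by rw [hn]; ring
  push_cast at h1 h2 h3 h4 hk
  rw [hm] at h1 h2 h3 h4 hk
  rw [show n - 2 + 1 - (k : R) - e = s - 2 by rw [hs]; ring,
    show n - 2 + 1 = n - 1 by ring] at h1
  rw [show n - 2 + 1 + 1 - (k : R) - e = s - 1 by rw [hs]; ring,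
    show n - 2 + 1 + 1 = n by ring] at h2
  rw [show n - 2 + 2 + 1 - (k : R) - e = s by rw [hs]; ring,
    show n - 2 + 2 + 1 = n + 1 by ring] at h3
  rw [show n - 2 + 3 + 1 - (k : R) - e = s + 1 by rw [hs]; ring,
    show n - 2 + 3 + 1 = n + 2 by ring] at h4
  rw [show n - 2 + 4 - (k : R) - e = s + 1 by rw [hs]; ring] at hk
  rw [← hs, show n + 1 - ((k + 1 : ℕ) : R) - e = s - 1 by rw [hs]; push_cast; ring]
  push_cast
  have hke : (k : R) + e = n + 1 - s := by rw [hs]; ring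
  rw [hke]
  rw [show (m + 1 + 1 : ℕ) = m + 2 from rfl] at h2
  rw [show (m + 2 + 1 : ℕ) = m + 3 from rfl] at h3
  rw [show (m + 3 + 1 : ℕ) = m + 4 from rfl] at h4
  generalize summandJet e (m + 4) (k + 1) = U at *
  generalize summandJet e (m + 4) k = T at *
  generalize summandJet e (m + 3) k = T3 at *
  generalize summandJet e (m + 2) k = T2 at *
  generalize summandJet e (m + 1) k = T1 at *
  generalize summandJet e m k = T0 at *
  generalize certificate n (s - 1) = z' at *
  generalize certificate n s = z at *
  generalize recCoeffAddTwo n = c4 at *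
  generalize recCoeffAddOne n = c3 at *
  generalize recCoeffZero n = c2 at *
  generalize recCoeffSubOne n = c1 at *
  generalize recCoeffSubTwo n = c0 at *
  have g2 : (n + 1) ^ 4 * (n + 2) ^ 4 * T2 = ((s + 1) * s) ^ 4 * T := by
    linear_combination -(n + 2) ^ 4 * h3 - s ^ 4 * h4
  have g1 : n ^ 4 * (n + 1) ^ 4 * (n + 2) ^ 4 * T1 = ((s + 1) * s * (s - 1)) ^ 4 * T := by
    linear_combination -((n + 1) * (n + 2)) ^ 4 * h2 + (s - 1) ^ 4 * g2
  have g0 : (n - 1) ^ 4 * n ^ 4 * (n + 1) ^ 4 * (n + 2) ^ 4 * T0 =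
      ((s + 1) * s * (s - 1) * (s - 2)) ^ 4 * T := by
    linear_combination -(n * (n + 1) * (n + 2)) ^ 4 * h1 + (s - 2) ^ 4 * g1
  have hk' : ((k : R) + 1 + e) ^ 3 * z' * U = (s + 1) ^ 4 * z' * T := by
    linear_combination z' * hk
  rw [hk']
  linear_combination T * hid + n ^ 2 * (n + 1) ^ 4 * c3 * h4 + n ^ 2 * c2 * g2 - c1 * g1 + c0 * g0

/-- The jet with coefficients `2 q_n`, `2 p_{n,1}`, `p_{n,2}`. -/
noncomputable def sumJet (e : R) (n : ℕ) : R :=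
  algebraMap ℚ R (2 * qseq4 n) + algebraMap ℚ R (2 * pseq41 n) * e +
    algebraMap ℚ R (pseq42 n) * e ^ 2

theorem sum_summandJet (e : R) {n N : ℕ} (h : n ≤ N) :
    ∑ k ∈ Finset.range (N + 1), summandJet e n k = sumJet e n := by
  rw [← Finset.sum_subset (Finset.range_mono (Nat.succ_le_succ h))
    fun k _ hk => summandJet_of_lt e (by simpa using hk)]
  simp only [sumJet, qseq4, pseq41, pseq42, map_sum, Finset.mul_sum, Finset.sum_mul,
    ← Finset.sum_add_distrib]
  refine Finset.sum_congr rfl fun k _ => ?_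
  simp only [summandJet, expJet, map_mul, map_add, map_pow, map_natCast, map_ofNat]
  ring

theorem sumJet_recurrence {e : R} (he : e ^ 3 = 0) (m : ℕ) (n : R) (hn : n = m + 2) :
    n ^ 2 * (n + 1) ^ 4 * (n + 2) ^ 4 *
        (recCoeffAddTwo n * sumJet e (m + 4) - recCoeffAddOne n * sumJet e (m + 3) +
          recCoeffZero n * sumJet e (m + 2) - n ^ 2 * recCoeffSubOne n * sumJet e (m + 1) +
          n ^ 2 * (n - 1) ^ 4 * recCoeffSubTwo n * sumJet e m) = 0 := by
  have h := Finset.sum_congr (rfl : Finset.range (m + 4 + 1) = _)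
    fun k _ => summandJet_telescoping he m k n hn
  rw [Finset.sum_range_sub (fun k : ℕ => ((k : R) + e) ^ 3 * certificate n (n + 1 - k - e) *
    summandJet e (m + 4) k), summandJet_of_lt e (Nat.lt_succ_self (m + 4))] at h
  simp only [← Finset.mul_sum, Finset.sum_add_distrib, Finset.sum_sub_distrib] at h
  rw [sum_summandJet e le_rfl, sum_summandJet e (by omega), sum_summandJet e (by omega),
    sum_summandJet e (by omega), sum_summandJet e (by omega)] at h
  rw [h, Nat.cast_zero, zero_add, he]
  ring

end Jets

open Polynomial in
theorem exists_jet_algebra : ∃ (R : Type) (_ : CommRing R) (_ : Algebra ℚ R) (e : R), e ^ 3 = 0 ∧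
    ∀ a b c : ℚ, algebraMap ℚ R a + algebraMap ℚ R b * e + algebraMap ℚ R c * e ^ 2 = 0 →
      a = 0 ∧ b = 0 ∧ c = 0 := by
  refine ⟨ℚ[X] ⧸ Ideal.span {(X : ℚ[X]) ^ 3}, inferInstance, inferInstance,
    Ideal.Quotient.mk _ X, ?_, fun a b c h => ?_⟩
  · rw [← map_pow]
    exact Ideal.Quotient.eq_zero_iff_mem.mpr (Ideal.mem_span_singleton_self _)
  · have h' : Ideal.Quotient.mk (Ideal.span {(X : ℚ[X]) ^ 3}) (C a + C b * X + C c * X ^ 2) = 0 := by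
      rw [map_add, map_add, map_mul, map_mul, map_pow]
      exact h
    rw [Ideal.Quotient.eq_zero_iff_mem, Ideal.mem_span_singleton, X_pow_dvd_iff] at h'
    have h0 := h' 0 (by norm_num)
    have h1 := h' 1 (by norm_num)
    have h2 := h' 2 (by norm_num)
    simp [coeff_X, coeff_C, coeff_X_pow] at h0 h1 h2
    exact ⟨h0, h1, h2⟩

theorem rec4_of_scaled {f : ℕ → ℚ} (h : ∀ m : ℕ, ∀ n : ℚ, n = m + 2 →
    n ^ 2 * (n + 1) ^ 4 * (n + 2) ^ 4 *
      (recCoeffAddTwo n * f (m + 4) - recCoeffAddOne n * f (m + 3) + recCoeffZero n * f (m + 2) -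
        n ^ 2 * recCoeffSubOne n * f (m + 1) +
        n ^ 2 * (n - 1) ^ 4 * recCoeffSubTwo n * f m) = 0) : Rec4 f := by
  intro n hn
  obtain ⟨m, rfl⟩ := Nat.exists_eq_add_of_le' hn
  have hm := h m ((m + 2 : ℕ) : ℚ) (by push_cast; ring)
  have hK : (((m + 2 : ℕ) : ℚ) ^ 2 * (((m + 2 : ℕ) : ℚ) + 1) ^ 4 *
      (((m + 2 : ℕ) : ℚ) + 2) ^ 4) ≠ 0 := by positivity
  have h0 := (mul_eq_zero.mp hm).resolve_left hK
  unfold recCoeffAddTwo recCoeffAddOne recCoeffZero recCoeffSubOne recCoeffSubTwo at h0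
  rw [show m + 2 + 2 = m + 4 from rfl, show m + 2 + 1 = m + 3 from rfl,
    show m + 2 - 1 = m + 1 from rfl, show m + 2 - 2 = m from rfl]
  linear_combination h0

theorem map_recCoeffs {R S : Type*} [CommRing R] [CommRing S] (φ : R →+* S) (n : R) :
    recCoeffAddTwo (φ n) = φ (recCoeffAddTwo n) ∧ recCoeffAddOne (φ n) = φ (recCoeffAddOne n) ∧
      recCoeffZero (φ n) = φ (recCoeffZero n) ∧ recCoeffSubOne (φ n) = φ (recCoeffSubOne n) ∧
      recCoeffSubTwo (φ n) = φ (recCoeffSubTwo n) := by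
  simp [recCoeffAddTwo, recCoeffAddOne, recCoeffZero, recCoeffSubOne, recCoeffSubTwo, map_ofNat]

theorem scaled_recurrences (m : ℕ) (n : ℚ) (hn : n = m + 2) :
    let L : (ℕ → ℚ) → ℚ := fun f => n ^ 2 * (n + 1) ^ 4 * (n + 2) ^ 4 *
      (recCoeffAddTwo n * f (m + 4) - recCoeffAddOne n * f (m + 3) + recCoeffZero n * f (m + 2) -
        n ^ 2 * recCoeffSubOne n * f (m + 1) + n ^ 2 * (n - 1) ^ 4 * recCoeffSubTwo n * f m)
    L qseq4 = 0 ∧ L pseq41 = 0 ∧ L pseq42 = 0 := by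
  intro L
  obtain ⟨R, _, _, e, he, hind⟩ := exists_jet_algebra
  have h := sumJet_recurrence he m (algebraMap ℚ R n) (by simp [hn, map_ofNat])
  obtain ⟨h4, h3, h2, h1, h0⟩ := map_recCoeffs (algebraMap ℚ R) n
  rw [h4, h3, h2, h1, h0] at h
  obtain ⟨ha, hb, hc⟩ := hind (2 * L qseq4) (2 * L pseq41) (L pseq42) (by
    rw [← h]
    simp only [L, sumJet, map_mul, map_add, map_sub, map_pow, map_one, map_ofNat]
    ring)
  exact ⟨by linarith, by linarith, hc⟩

theorem stmt_12 : Rec4 qseq4 ∧ Rec4 pseq41 ∧ Rec4 pseq42 :=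
  ⟨rec4_of_scaled fun m n hn => (scaled_recurrences m n hn).1,
    rec4_of_scaled fun m n hn => (scaled_recurrences m n hn).2.1,
    rec4_of_scaled fun m n hn => (scaled_recurrences m n hn).2.2⟩
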